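/- Suppose m̃ ∈ S^k satisfies g(m̃) ≤ ρ · min_{m ∈ S^k} g(m) for some ρ ≥ 1, and let μ̃_d be the decentralized policy that maps a state x = (x̂, x₁,…,x_k) to an index i such that d(m̃_i, x̂) ≤ d(m̃_j, x̂) for all j ∈ Fin k (ties broken by a fixed rule). Then for every state-feedback policy μ : X → U and all initial states x₀, x₀' ∈ X, J̄(μ̃_d, x₀) ≤ 2ρ · J_(μ, x₀'). -/

import Mathlib

open Filter Finset

/-- Distribution of the chain after `t` steps under kernel `K`, started at `x₀`:
the `t`-fold monadic bind of `K` applied to the point mass at `x₀`. -/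
noncomputable def chainDist {X : Type*} (K : X → PMF X) (x₀ : X) : ℕ → PMF X
  | 0 => PMF.pure x₀
  | t + 1 => (chainDist K x₀ t).bind K

/-- Expectation of `f` under a PMF on a finite type. -/
noncomputable def pmfExp {X : Type*} [Fintype X] (q : PMF X) (f : X → ℝ) : ℝ :=
  ∑ x, (q x).toReal * f x

/-- The average cost over periods `0,…,T` of running the Markov chain with step
kernel `K` and per-stage cost `c`, started at `x₀`. -/
noncomputable def avgCost {X : Type*} [Fintype X] (K : X → PMF X) (c : X → ℝ)
    (x₀ : X) (T : ℕ) : ℝ :=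
  (1 / (T + 1 : ℝ)) * ∑ t ∈ Finset.range (T + 1), pmfExp (chainDist K x₀ t) c

/-- Step kernel of the stochastic `k`-server problem under policy `μ`: the state is
`(x̂, x₁, …, x_k)`; server `μ x` relocates to the request location `x.1` and the next
request is drawn from `p`. -/
noncomputable def kServerKernel {S : Type*} {k : ℕ} (p : PMF S)
    (μ : S × (Fin k → S) → Fin k) (x : S × (Fin k → S)) : PMF (S × (Fin k → S)) :=
  p.map (fun s => (s, Function.update x.2 (μ x) x.1))

/-- Per-stage cost of the stochastic `k`-server problem under policy `μ`:
the distance from the dispatched server to the request location. -/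
noncomputable def kServerCost {S : Type*} [MetricSpace S] {k : ℕ}
    (μ : S × (Fin k → S) → Fin k) (x : S × (Fin k → S)) : ℝ :=
  dist (x.2 (μ x)) x.1

/-- The `k`-median objective `g(m) = Σ_s p(s) · min_i d(m_i, s)`. -/
noncomputable def kMedian {S : Type*} [Fintype S] [MetricSpace S] {k : ℕ} [NeZero k]
    (p : PMF S) (m : Fin k → S) : ℝ :=
  ∑ s, (p s).toReal * Finset.univ.inf' Finset.univ_nonempty (fun i => dist (m i) s)

section PmfExp

variable {X Y : Type*} [Fintype X] [Fintype Y]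

theorem pmfExp_mono (q : PMF X) {f g : X → ℝ} (h : ∀ x, f x ≤ g x) :
    pmfExp q f ≤ pmfExp q g :=
  Finset.sum_le_sum fun x _ => mul_le_mul_of_nonneg_left (h x) ENNReal.toReal_nonneg

theorem pmfExp_add (q : PMF X) (f g : X → ℝ) :
    pmfExp q (fun x => f x + g x) = pmfExp q f + pmfExp q g := by
  simp only [pmfExp, mul_add, Finset.sum_add_distrib]

theorem pmfExp_const_mul (q : PMF X) (a : ℝ) (f : X → ℝ) :
    pmfExp q (fun x => a * f x) = a * pmfExp q f := by
  simp only [pmfExp, Finset.mul_sum, mul_left_comm]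

theorem pmfExp_const (q : PMF X) (a : ℝ) : pmfExp q (fun _ => a) = a := by
  have hq : ∑ x, (q x).toReal = 1 := by
    rw [← ENNReal.toReal_sum fun x _ => q.apply_ne_top x, ← tsum_fintype (L := .unconditional X),
      q.tsum_coe, ENNReal.toReal_one]
  rw [pmfExp, ← Finset.sum_mul, hq, one_mul]

theorem pmfExp_nonneg (q : PMF X) {f : X → ℝ} (h : ∀ x, 0 ≤ f x) : 0 ≤ pmfExp q f :=
  Finset.sum_nonneg fun x _ => mul_nonneg ENNReal.toReal_nonneg (h x)

theorem pmfExp_pure (x : X) (f : X → ℝ) : pmfExp (PMF.pure x) f = f x := by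
  classical
  rw [pmfExp, Finset.sum_eq_single x] <;> simp +contextual [PMF.pure_apply]

theorem pmfExp_bind (q : PMF X) (K : X → PMF Y) (f : Y → ℝ) :
    pmfExp (q.bind K) f = pmfExp q fun x => pmfExp (K x) f := by
  have h (y : Y) : ((q.bind K) y).toReal = ∑ x, (q x).toReal * (K x y).toReal := by
    rw [PMF.bind_apply, tsum_fintype, ENNReal.toReal_sum fun x _ =>
      ENNReal.mul_ne_top (q.apply_ne_top x) ((K x).apply_ne_top y)]
    simp only [ENNReal.toReal_mul]
  simp only [pmfExp, h, Finset.sum_mul, Finset.mul_sum]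
  rw [Finset.sum_comm]
  simp only [mul_assoc]

theorem pmfExp_map (q : PMF X) (F : X → Y) (f : Y → ℝ) :
    pmfExp (q.map F) f = pmfExp q fun x => f (F x) := by
  rw [← PMF.bind_pure_comp, pmfExp_bind]
  simp only [Function.comp_apply, pmfExp_pure]

theorem avgCost_nonneg (K : X → PMF X) {c : X → ℝ} (hc : ∀ x, 0 ≤ c x) (x₀ : X) (T : ℕ) :
    0 ≤ avgCost K c x₀ T :=
  mul_nonneg (by positivity) (Finset.sum_nonneg fun _ _ => pmfExp_nonneg _ hc)

theorem avgCost_le (K : X → PMF X) {c : X → ℝ} {B : ℝ} (hc : ∀ x, c x ≤ B) (x₀ : X) (T : ℕ) :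
    avgCost K c x₀ T ≤ B := by
  have h : ∑ t ∈ Finset.range (T + 1), pmfExp (chainDist K x₀ t) c ≤ (T + 1 : ℝ) * B := by
    refine (Finset.sum_le_card_nsmul _ _ B fun t _ => ?_).trans_eq (by simp)
    exact (pmfExp_mono _ hc).trans_eq (pmfExp_const _ B)
  rw [avgCost, one_div, inv_mul_le_iff₀ (by positivity)]
  exact h

end PmfExp

theorem limsup_le_of_le_add_div {u : ℕ → ℝ} {a C : ℝ} (h0 : ∀ T, 0 ≤ u T)
    (h : ∀ T : ℕ, u T ≤ a + C / (T + 1 : ℝ)) : limsup u atTop ≤ a := by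
  have hlim : Tendsto (fun T : ℕ => a + C / (T + 1 : ℝ)) atTop (nhds a) := by
    simpa [div_eq_mul_inv] using
      (tendsto_one_div_add_atTop_nhds_zero_nat (𝕜 := ℝ)).const_mul C |>.const_add a
  rw [← hlim.limsup_eq]
  exact limsup_le_limsup (.of_forall h)
    (isBoundedUnder_of ⟨0, h0⟩ : IsBoundedUnder (· ≥ ·) atTop u).isCoboundedUnder_le
    hlim.isBoundedUnder_le

theorem le_liminf_of_sub_div_le {u : ℕ → ℝ} {a B C : ℝ} (hB : ∀ T, u T ≤ B)
    (h : ∀ T : ℕ, a - C / (T + 1 : ℝ) ≤ u T) : a ≤ liminf u atTop := by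
  have hlim : Tendsto (fun T : ℕ => a - C / (T + 1 : ℝ)) atTop (nhds a) := by
    simpa [div_eq_mul_inv] using
      (tendsto_one_div_add_atTop_nhds_zero_nat (𝕜 := ℝ)).const_mul C |>.const_sub a
  rw [← hlim.liminf_eq]
  exact liminf_le_liminf (.of_forall h) hlim.isBoundedUnder_ge
    (isBoundedUnder_of ⟨B, hB⟩ : IsBoundedUnder (· ≤ ·) atTop u).isCoboundedUnder_ge

theorem pmfExp_chainDist_kServerKernel_succ {S : Type*} [Fintype S] {k : ℕ}
    (p : PMF S) (μ : S × (Fin k → S) → Fin k)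
    (x₀ : S × (Fin k → S)) (t : ℕ) (f : S × (Fin k → S) → ℝ) :
    pmfExp (chainDist (kServerKernel p μ) x₀ (t + 1)) f =
      pmfExp (chainDist (kServerKernel p μ) x₀ t) fun x =>
        pmfExp p fun s => f (s, Function.update x.2 (μ x) x.1) := by
  simp only [chainDist, pmfExp_bind, kServerKernel, pmfExp_map]

section KServer

variable {S : Type*} [MetricSpace S] {k : ℕ}

theorem kServerCost_nonneg (μ : S × (Fin k → S) → Fin k) (x : S × (Fin k → S)) :
    0 ≤ kServerCost μ x :=
  dist_nonneg

/-- The sum of distances between the servers and their home positions `m` serves as a potential: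
dispatching server `i` to `s` costs, after the change of potential, at most `2 * dist (m i) s`. -/
theorem dist_add_sum_dist_update_le (m y : Fin k → S) (i : Fin k) (s : S) :
    dist (y i) s + ∑ j, dist (Function.update y i s j) (m j) ≤
      ∑ j, dist (y j) (m j) + 2 * dist (m i) s := by
  have h : ∑ j ∈ Finset.univ.erase i, dist (Function.update y i s j) (m j) =
      ∑ j ∈ Finset.univ.erase i, dist (y j) (m j) :=
    Finset.sum_congr rfl fun j hj => by
      rw [Function.update_of_ne (Finset.ne_of_mem_erase hj)]
  rw [← Finset.add_sum_erase _ _ (Finset.mem_univ i), h,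
    ← Finset.add_sum_erase _ (fun j => dist (y j) (m j)) (Finset.mem_univ i),
    Function.update_self, dist_comm s]
  linarith [dist_triangle (y i) (m i) s]

variable [Fintype S] [NeZero k]

theorem pmfExp_dist_nearest (p : PMF S) (m : Fin k → S) (ν : S → Fin k)
    (hν : ∀ s j, dist (m (ν s)) s ≤ dist (m j) s) :
    pmfExp p (fun s => dist (m (ν s)) s) = kMedian p m := by
  refine Finset.sum_congr rfl fun s _ => ?_
  congr 1
  exact le_antisymm (Finset.le_inf' _ _ fun j _ => hν s j)
    (Finset.inf'_le (fun i => dist (m i) s) (Finset.mem_univ (ν s)))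

theorem kMedian_le_pmfExp_dist (p : PMF S) (m : Fin k → S) (ν : S → Fin k) :
    kMedian p m ≤ pmfExp p fun s => dist (m (ν s)) s :=
  pmfExp_mono p fun s => Finset.inf'_le (fun i => dist (m i) s) (Finset.mem_univ (ν s))

theorem kMedian_nonneg (p : PMF S) (m : Fin k → S) : 0 ≤ kMedian p m :=
  pmfExp_nonneg p fun _ => Finset.le_inf' _ _ fun _ _ => dist_nonneg

theorem limsup_avgCost_le_two_mul_kMedian (p : PMF S) (m : Fin k → S)
    (μ : S × (Fin k → S) → Fin k)
    (hμ : ∀ x : S × (Fin k → S), ∀ j, dist (m (μ x)) x.1 ≤ dist (m j) x.1)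
    (x₀ : S × (Fin k → S)) :
    limsup (avgCost (kServerKernel p μ) (kServerCost μ) x₀) atTop ≤ 2 * kMedian p m := by
  set E : ℕ → (S × (Fin k → S) → ℝ) → ℝ :=
    fun t => pmfExp (chainDist (kServerKernel p μ) x₀ t) with hE
  set Φ : S × (Fin k → S) → ℝ := fun x => ∑ j, dist (x.2 j) (m j) with hΦ
  set h : S × (Fin k → S) → ℝ := fun x => dist (m (μ x)) x.1
  have hstep (t : ℕ) : E t (kServerCost μ) + E (t + 1) Φ ≤ E t Φ + 2 * E t h := by
    simp only [hE]
    rw [pmfExp_chainDist_kServerKernel_succ, ← pmfExp_add, ← pmfExp_const_mul, ← pmfExp_add]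
    refine pmfExp_mono _ fun x => ?_
    simp only [hΦ, pmfExp_const]
    exact dist_add_sum_dist_update_le m x.2 (μ x) x.1
  have hmed (t : ℕ) : E (t + 1) h = kMedian p m := by
    simp only [hE]
    rw [pmfExp_chainDist_kServerKernel_succ]
    refine Eq.trans ?_ (pmfExp_const (chainDist (kServerKernel p μ) x₀ t) _)
    congr 1
    funext x
    exact pmfExp_dist_nearest p m (fun s => μ (s, Function.update x.2 (μ x) x.1))
      fun s => hμ (s, Function.update x.2 (μ x) x.1)
  have hsum (T : ℕ) : ∑ t ∈ Finset.range (T + 1), E t (kServerCost μ) + E (T + 1) Φ ≤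
      E 0 Φ + 2 * E 0 h + T * (2 * kMedian p m) := by
    induction T with
    | zero => simpa using hstep 0
    | succ T ih =>
      rw [Finset.sum_range_succ]
      have := hstep (T + 1)
      rw [hmed] at this
      push_cast
      linarith
  refine limsup_le_of_le_add_div (C := E 0 Φ + 2 * E 0 h)
    (avgCost_nonneg _ (kServerCost_nonneg μ) x₀) fun T => ?_
  have hT : (0 : ℝ) < T + 1 := by positivity
  have hΦT : 0 ≤ E (T + 1) Φ := pmfExp_nonneg _ fun x => Finset.sum_nonneg fun j _ => dist_nonneg
  rw [avgCost, one_div, inv_mul_le_iff₀ hT, mul_add, mul_div_cancel₀ _ hT.ne']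
  linarith [hsum T, kMedian_nonneg p m]

theorem le_liminf_avgCost (p : PMF S) {a : ℝ} (ha : ∀ m : Fin k → S, a ≤ kMedian p m)
    (μ : S × (Fin k → S) → Fin k) (x₀ : S × (Fin k → S)) :
    a ≤ liminf (avgCost (kServerKernel p μ) (kServerCost μ) x₀) atTop := by
  have hstep (t : ℕ) :
      a ≤ pmfExp (chainDist (kServerKernel p μ) x₀ (t + 1)) (kServerCost μ) := by
    rw [pmfExp_chainDist_kServerKernel_succ]
    refine (pmfExp_const _ a).symm.trans_le (pmfExp_mono _ fun x => ?_)
    exact (ha _).trans (kMedian_le_pmfExp_dist p (Function.update x.2 (μ x) x.1)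
      fun s => μ (s, Function.update x.2 (μ x) x.1))
  obtain ⟨B, hB⟩ := (Set.finite_range (kServerCost μ)).bddAbove
  refine le_liminf_of_sub_div_le (B := B) (C := a)
    (avgCost_le _ (fun x => hB (Set.mem_range_self x)) x₀) fun T => ?_
  have hT : (0 : ℝ) < T + 1 := by positivity
  rw [avgCost, one_div, le_inv_mul_iff₀ hT, mul_sub, mul_div_cancel₀ _ hT.ne',
    Finset.sum_range_succ']
  have hsum := Finset.card_nsmul_le_sum (Finset.range T) _ a fun t _ => hstep t
  rw [Finset.card_range, nsmul_eq_mul] at hsum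
  have h0 := pmfExp_nonneg (chainDist (kServerKernel p μ) x₀ 0) (kServerCost_nonneg μ)
  linarith

end KServer

/-- A decentralized policy built from a factor-`ρ` suboptimal `k`-median solution has
limsup average cost at most `2ρ` times the liminf average cost of any policy. -/
theorem decentralized_policy_from_approx_kMedian
    {S : Type*} [Fintype S] [Nonempty S] [MetricSpace S] {k : ℕ} [NeZero k]
    (p : PMF S) (mtilde : Fin k → S) (ρ : ℝ) (hρ : 1 ≤ ρ)
    (hm : kMedian p mtilde ≤
      ρ * Finset.univ.inf' Finset.univ_nonempty (fun m : Fin k → S => kMedian p m))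
    (μd : S × (Fin k → S) → Fin k)
    (hμd : ∀ x : S × (Fin k → S), ∀ j : Fin k,
      dist (mtilde (μd x)) x.1 ≤ dist (mtilde j) x.1)
    (μ : S × (Fin k → S) → Fin k) (x₀ x₀' : S × (Fin k → S)) :
    limsup (avgCost (kServerKernel p μd) (kServerCost μd) x₀) atTop ≤
      2 * ρ * liminf (avgCost (kServerKernel p μ) (kServerCost μ) x₀') atTop := by
  refine (limsup_avgCost_le_two_mul_kMedian p mtilde μd hμd x₀).trans ?_
  have hlow := le_liminf_avgCost p
    (a := Finset.univ.inf' Finset.univ_nonempty fun m : Fin k → S => kMedian p m)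
    (fun m => Finset.inf'_le _ (Finset.mem_univ m)) μ x₀'
  have := mul_le_mul_of_nonneg_left hlow (zero_le_one.trans hρ)
  linarith
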